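/- arXiv:1311.0121 — 2 statements merged into one kernel-verified Lean document; each statement's English description precedes it below -/
import Mathlib

section
/- Let Φ ∈ ℝ^{m×N} satisfy the RIP of order t with constant δ ∈ [0,1], and let μ ≥ 0 be a real number. Then for any two vectors u, v ∈ ℝ^N with |supp(u) ∪ supp(v)| ≤ t, one has |⟨u, (I − μΦ*Φ)v⟩| ≤ (|μ−1| + μδ)·‖u‖₂·‖v‖₂, where I is the N×N identity matrix and ⟨·,·⟩ is the Euclidean inner product. -/
open Matrix Finset

/-- The Euclidean norm of a vector in `ℝⁿ`. -/
noncomputable def norm2 {n : ℕ} (v : Fin n → ℝ) : ℝ := Real.sqrt (∑ i, (v i) ^ 2)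

/-- The support of a vector: the set of indices of its nonzero entries. -/
noncomputable def supp {n : ℕ} (v : Fin n → ℝ) : Finset (Fin n) :=
  Finset.univ.filter (fun i => v i ≠ 0)

/-- `restrict v T` keeps the entries of `v` with indices in `T` and sets all others to zero. -/
def restrict {n : ℕ} (v : Fin n → ℝ) (T : Finset (Fin n)) : Fin n → ℝ :=
  fun i => if i ∈ T then v i else 0

/-- `Φ` satisfies the restricted isometry property of order `t` with constant `δ`. -/
def RIP (m N : ℕ) (Φ : Matrix (Fin m) (Fin N) ℝ) (t : ℕ) (δ : ℝ) : Prop :=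
  ∀ v : Fin N → ℝ, (supp v).card ≤ t →
    (1 - δ) * (norm2 v) ^ 2 ≤ (norm2 (Φ.mulVec v)) ^ 2 ∧
    (norm2 (Φ.mulVec v)) ^ 2 ≤ (1 + δ) * (norm2 v) ^ 2

/-- `z` is a least-squares solution over support `T` for data `y`. -/
def IsLeastSquares {m N : ℕ} (Φ : Matrix (Fin m) (Fin N) ℝ) (y : Fin m → ℝ)
    (T : Finset (Fin N)) (z : Fin N → ℝ) : Prop :=
  supp z ⊆ T ∧ ∀ w : Fin N → ℝ, supp w ⊆ T →
    norm2 (y - Φ.mulVec z) ≤ norm2 (y - Φ.mulVec w)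

/-- `U` is a set of indices of the `k` largest magnitude entries of `v`. -/
def IsLargest {n : ℕ} (v : Fin n → ℝ) (k : ℕ) (U : Finset (Fin n)) : Prop :=
  U.card = k ∧ ∀ i ∈ U, ∀ j ∉ U, |v j| ≤ |v i|

theorem norm2_sq_dot {n : ℕ} (v : Fin n → ℝ) : norm2 v ^ 2 = v ⬝ᵥ v := by
  unfold norm2
  rw [Real.sq_sqrt (Finset.sum_nonneg fun i _ => sq_nonneg _)]
  simp [dotProduct, sq]

theorem quad_bound {m N : ℕ} (Φ : Matrix (Fin m) (Fin N) ℝ) (t : ℕ) (δ μ : ℝ)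
    (hμ : 0 ≤ μ) (hRIP : RIP m N Φ t δ)
    (w : Fin N → ℝ) (h : (supp w).card ≤ t) :
    |w ⬝ᵥ w - μ * (Φ.mulVec w ⬝ᵥ Φ.mulVec w)| ≤ (|μ - 1| + μ * δ) * (w ⬝ᵥ w) := by
  obtain ⟨h1, h2⟩ := hRIP w h
  have h0 : 0 ≤ w ⬝ᵥ w := by rw [← norm2_sq_dot]; positivity
  rw [norm2_sq_dot, norm2_sq_dot] at h1 h2
  have e1 := mul_le_mul_of_nonneg_left h1 hμ
  have e2 := mul_le_mul_of_nonneg_left h2 hμ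
  have e3 := mul_le_mul_of_nonneg_right (le_abs_self (μ - 1)) h0
  have e4 := mul_le_mul_of_nonneg_right (neg_abs_le (μ - 1)) h0
  rw [abs_le]
  constructor <;> nlinarith

theorem stmt_0 {m N : ℕ} (Φ : Matrix (Fin m) (Fin N) ℝ) (t : ℕ) (δ μ : ℝ)
    (hδ0 : 0 ≤ δ) (hδ1 : δ ≤ 1) (hμ : 0 ≤ μ) (hRIP : RIP m N Φ t δ)
    (u v : Fin N → ℝ) (hcard : (supp u ∪ supp v).card ≤ t) :
    |∑ i, u i * (v i - μ * (Φᵀ.mulVec (Φ.mulVec v)) i)| ≤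
      (|μ - 1| + μ * δ) * norm2 u * norm2 v := by
  have hB : ∑ i, u i * (v i - μ * (Φᵀ.mulVec (Φ.mulVec v)) i)
      = u ⬝ᵥ v - μ * (Φ.mulVec u ⬝ᵥ Φ.mulVec v) := by
    have : Φ.mulVec u ⬝ᵥ Φ.mulVec v = u ⬝ᵥ (Φᵀ.mulVec (Φ.mulVec v)) := by
      rw [Matrix.dotProduct_mulVec u, Matrix.vecMul_transpose]
    rw [this]
    simp only [dotProduct, Finset.mul_sum, ← Finset.sum_sub_distrib]
    exact Finset.sum_congr rfl fun i _ => by ring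
  rw [hB]
  have hs : ∀ a b : ℝ, (supp (a • u + b • v)).card ≤ t := by
    intro a b
    refine le_trans (Finset.card_le_card ?_) hcard
    intro i hi
    simp only [supp, Finset.mem_union, Finset.mem_filter, Finset.mem_univ, true_and] at hi ⊢
    by_contra! hc
    apply hi
    simp [hc.1, hc.2]
  have key : ∀ a b : ℝ, 2 * (a * b) * (u ⬝ᵥ v - μ * (Φ.mulVec u ⬝ᵥ Φ.mulVec v)) ≤
      (|μ - 1| + μ * δ) * (a ^ 2 * norm2 u ^ 2 + b ^ 2 * norm2 v ^ 2) := by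
    intro a b
    have h1 := (abs_le.mp (quad_bound Φ t δ μ hμ hRIP _ (hs a b))).2
    have h2 := (abs_le.mp (quad_bound Φ t δ μ hμ hRIP _ (hs a (-b)))).1
    simp only [Matrix.mulVec_add, Matrix.mulVec_smul, dotProduct_add, add_dotProduct,
      smul_dotProduct, dotProduct_smul, smul_eq_mul, dotProduct_comm v u,
      dotProduct_comm (Φ.mulVec v) (Φ.mulVec u)] at h1 h2
    rw [norm2_sq_dot, norm2_sq_dot]
    linarith
  have hz : ∀ {n : ℕ} (x : Fin n → ℝ), norm2 x = 0 → x = 0 := by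
    intro n x hx
    have := norm2_sq_dot x
    rw [hx] at this
    exact dotProduct_self_eq_zero.mp (by linarith)
  have hp : 0 ≤ norm2 u := Real.sqrt_nonneg _
  have hq : 0 ≤ norm2 v := Real.sqrt_nonneg _
  rcases hp.eq_or_lt with hp0 | hp0
  · rw [← hp0, hz u hp0.symm]; simp
  rcases hq.eq_or_lt with hq0 | hq0
  · rw [← hq0, hz v hq0.symm]; simp
  have k1 := key (norm2 v) (norm2 u)
  have k2 := key (norm2 v) (-norm2 u)
  have hpq : 0 < 2 * (norm2 v * norm2 u) := by positivity
  rw [abs_le]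
  constructor
  · refine le_of_mul_le_mul_left ?_ hpq
    linarith
  · refine le_of_mul_le_mul_left ?_ hpq
    linarith
end

section
/- Let Φ ∈ ℝ^{m×N}, let S ⊆ {1,…,N} with |S| ≤ s, let x ∈ ℝ^N, e′ ∈ ℝ^m, and set y = Φx_S + e′. Let T ⊆ {1,…,N} with |T| = t, and let z_p be a least-squares solution over support T for data y. Suppose Φ satisfies the RIP of order s+t with constant δ₁ < 1 and the RIP of order t with constant δ₂. Then ‖x_S − z_p‖₂ ≤ √(1/(1−δ₁²))·‖(x_S)_{T̄}‖₂ + (√(1+δ₂)/(1−δ₁))·‖e′‖₂. -/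
open Matrix Finset

theorem my_le_of_sq_le {a b : ℝ} (h : a ^ 2 ≤ b ^ 2) (hb : 0 ≤ b) : a ≤ b :=
  (le_abs_self a).trans (abs_le_of_sq_le_sq h hb)

theorem norm2_sq {n : ℕ} (v : Fin n → ℝ) : (norm2 v) ^ 2 = v ⬝ᵥ v := by
  unfold norm2
  rw [Real.sq_sqrt (Finset.sum_nonneg fun i _ => sq_nonneg _)]
  simp [dotProduct, sq]

theorem norm2_nonneg {n : ℕ} (v : Fin n → ℝ) : 0 ≤ norm2 v := Real.sqrt_nonneg _

theorem dot_le_norm2 {n : ℕ} (v w : Fin n → ℝ) : |v ⬝ᵥ w| ≤ norm2 v * norm2 w := by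
  apply abs_le_of_sq_le_sq _ (mul_nonneg (norm2_nonneg v) (norm2_nonneg w))
  rw [mul_pow, norm2_sq, norm2_sq]
  have := Finset.sum_mul_sq_le_sq_mul_sq Finset.univ v w
  simpa [dotProduct, sq] using this

theorem supp_subset_iff {n : ℕ} (v : Fin n → ℝ) (T : Finset (Fin n)) :
    supp v ⊆ T ↔ ∀ i, i ∉ T → v i = 0 := by
  unfold supp
  constructor
  · intro h i hi
    by_contra hv
    exact hi (h (by simp [hv]))
  · intro h i hi
    by_contra hv
    simp [h i hv] at hi

theorem rip_inner {m N : ℕ} (Φ : Matrix (Fin m) (Fin N) ℝ) (k : ℕ) (δ : ℝ)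
    (h : RIP m N Φ k δ) (U : Finset (Fin N)) (hU : U.card ≤ k) (v w : Fin N → ℝ)
    (hv : supp v ⊆ U) (hw : supp w ⊆ U) (hv0 : 0 < norm2 v) (hw0 : 0 < norm2 w) :
    v ⬝ᵥ w - (Φ.mulVec v) ⬝ᵥ (Φ.mulVec w) ≤ δ * (norm2 v * norm2 w) := by
  rw [supp_subset_iff] at hv hw
  set p := norm2 v with hp
  set q := norm2 w with hq
  have hpp : p ^ 2 = v ⬝ᵥ v := norm2_sq v
  have hqq : q ^ 2 = w ⬝ᵥ w := norm2_sq w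
  have h1 := (h (q • v + p • w) ((Finset.card_le_card ((supp_subset_iff _ U).2
    (fun i hi => by simp [hv i hi, hw i hi]))).trans hU)).1
  have h2 := (h (q • v - p • w) ((Finset.card_le_card ((supp_subset_iff _ U).2
    (fun i hi => by simp [hv i hi, hw i hi]))).trans hU)).2
  simp only [norm2_sq, mulVec_add, mulVec_sub, mulVec_smul, add_dotProduct, dotProduct_add,
    sub_dotProduct, dotProduct_sub, smul_dotProduct, dotProduct_smul, smul_eq_mul,
    dotProduct_comm w v, dotProduct_comm (Φ.mulVec w) (Φ.mulVec v), ← hpp, ← hqq] at h1 h2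
  have hpq : 0 < p * q := mul_pos hv0 hw0
  refine le_of_mul_le_mul_left ?_ hpq
  nlinarith

theorem ls_orth {m N : ℕ} (Φ : Matrix (Fin m) (Fin N) ℝ) (y : Fin m → ℝ)
    (T : Finset (Fin N)) (z : Fin N → ℝ) (h : IsLeastSquares Φ y T z)
    (w : Fin N → ℝ) (hw : supp w ⊆ T) : (y - Φ.mulVec z) ⬝ᵥ (Φ.mulVec w) = 0 := by
  obtain ⟨hz, hmin⟩ := h
  rw [supp_subset_iff] at hz hw
  have key : ∀ τ : ℝ, 0 ≤ (-2 * τ) * ((y - Φ.mulVec z) ⬝ᵥ (Φ.mulVec w))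
      + τ ^ 2 * ((Φ.mulVec w) ⬝ᵥ (Φ.mulVec w)) := by
    intro τ
    have h1 := hmin (z + τ • w) ((supp_subset_iff _ T).2
      (fun i hi => by simp [hz i hi, hw i hi]))
    have h2 := pow_le_pow_left₀ (norm2_nonneg _) h1 2
    rw [mulVec_add, mulVec_smul, ← sub_sub, norm2_sq, norm2_sq] at h2
    generalize y - Φ.mulVec z = r at h2 ⊢
    simp only [sub_dotProduct, dotProduct_sub, smul_dotProduct, dotProduct_smul, smul_eq_mul,
      dotProduct_comm (Φ.mulVec w) r] at h2
    linarith
  generalize (y - Φ.mulVec z) ⬝ᵥ (Φ.mulVec w) = A at key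
  have hB : 0 ≤ (Φ.mulVec w) ⬝ᵥ (Φ.mulVec w) := by rw [← norm2_sq]; positivity
  generalize (Φ.mulVec w) ⬝ᵥ (Φ.mulVec w) = B at key hB
  have h3 := key (A / (B + 1))
  have h4 : (-2 * (A / (B + 1))) * A + (A / (B + 1)) ^ 2 * B
      = - (A ^ 2 * ((B + 2) / (B + 1) ^ 2)) := by
    field_simp
    ring
  rw [h4] at h3
  by_contra hA
  have : 0 < A ^ 2 * ((B + 2) / (B + 1) ^ 2) := by positivity
  linarith

theorem scalar_bound (n a b c δ : ℝ) (hb : 0 ≤ b) (hc : 0 ≤ c)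
    (h0 : 0 ≤ δ) (h1 : δ < 1) (ha : 0 ≤ a) (hab : n ^ 2 = a ^ 2 + b ^ 2)
    (hle : a ≤ δ * n + c) : n ≤ Real.sqrt (1 / (1 - δ ^ 2)) * b + c / (1 - δ) := by
  have hpos : 0 < 1 - δ ^ 2 := by nlinarith
  rw [Real.sqrt_div zero_le_one, Real.sqrt_one]
  have hq := Real.sqrt_pos.2 hpos
  have hqq := Real.sq_sqrt hpos.le
  set q := Real.sqrt (1 - δ ^ 2)
  have hk : q ^ 2 * n - δ * c ≤ c + q * b := by
    apply my_le_of_sq_le _ (by positivity)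
    have h2 : a ^ 2 ≤ (δ * n + c) ^ 2 := pow_le_pow_left₀ ha hle 2
    have h3 : q ^ 2 * n ^ 2 - 2 * δ * c * n - c ^ 2 - b ^ 2 ≤ 0 := by rw [hqq]; nlinarith
    have h4 := mul_le_mul_of_nonneg_left h3 (sq_nonneg q)
    have h5 : 0 ≤ c * (q * b) := by positivity
    have h6 : q ^ 2 * c ^ 2 = (1 - δ ^ 2) * c ^ 2 := by rw [hqq]
    nlinarith
  have h7 : 1 / q * b + c / (1 - δ) = (c + q * b + δ * c) / q ^ 2 := by
    have : (1 - δ) ≠ 0 := by linarith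
    have h8 : c / (1 - δ) = (1 + δ) * c / q ^ 2 := by
      rw [hqq, div_eq_div_iff this hpos.ne']; ring
    rw [h8]; field_simp; ring
  rw [h7, le_div_iff₀ (by positivity)]
  linarith

theorem stmt_5 {m N : ℕ} (Φ : Matrix (Fin m) (Fin N) ℝ) (s t : ℕ)
    (S : Finset (Fin N)) (hS : S.card ≤ s)
    (x : Fin N → ℝ) (e' : Fin m → ℝ) (y : Fin m → ℝ)
    (hy : y = Φ.mulVec (restrict x S) + e')
    (T : Finset (Fin N)) (hT : T.card = t)
    (zp : Fin N → ℝ) (hzp : IsLeastSquares Φ y T zp)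
    (δ₁ δ₂ : ℝ) (hδ₁0 : 0 ≤ δ₁) (hδ₁1 : δ₁ < 1) (hδ₂0 : 0 ≤ δ₂) (hδ₂1 : δ₂ ≤ 1)
    (hRIP1 : RIP m N Φ (s + t) δ₁) (hRIP2 : RIP m N Φ t δ₂) :
    norm2 (restrict x S - zp) ≤
      Real.sqrt (1 / (1 - δ₁ ^ 2)) * norm2 (restrict (restrict x S) Tᶜ) +
        (Real.sqrt (1 + δ₂) / (1 - δ₁)) * norm2 e' := by
  set u := restrict x S with hu
  have huS : ∀ i, i ∉ S → u i = 0 := fun i hi => by simp [hu, _root_.restrict, hi]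
  have hz : ∀ i, i ∉ T → zp i = 0 := (supp_subset_iff _ _).1 hzp.1
  set d := u - zp with hd
  set w := restrict d T with hw
  have hwT : supp w ⊆ T := (supp_subset_iff _ _).2 fun i hi => by simp [hw, _root_.restrict, hi]
  have hdU : supp d ⊆ S ∪ T := (supp_subset_iff _ _).2 fun i hi => by
    simp only [Finset.mem_union, not_or] at hi
    simp [hd, huS i hi.1, hz i hi.2]
  have hdw : d ⬝ᵥ w = norm2 w ^ 2 := by
    rw [norm2_sq]
    apply Finset.sum_congr rfl
    intro i _
    by_cases hi : i ∈ T <;> simp [hw, _root_.restrict, hi]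
  have hsplit : norm2 d ^ 2 = norm2 w ^ 2 + norm2 (restrict u Tᶜ) ^ 2 := by
    rw [norm2_sq, norm2_sq, norm2_sq]
    simp only [dotProduct]
    rw [← Finset.sum_add_distrib]
    apply Finset.sum_congr rfl
    intro i _
    by_cases hi : i ∈ T
    · simp [hw, _root_.restrict, hi]
    · simp [hw, _root_.restrict, hi, hd, hz i hi]
  have hb := norm2_nonneg (restrict u Tᶜ)
  have hn := norm2_nonneg d
  have he := norm2_nonneg e'
  rw [div_mul_eq_mul_div]
  refine scalar_bound (norm2 d) (norm2 w) _ (Real.sqrt (1 + δ₂) * norm2 e') δ₁ hb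
    (by positivity) hδ₁0 hδ₁1 (norm2_nonneg w) hsplit ?_
  rcases (norm2_nonneg w).eq_or_lt with hw0 | hw0
  · rw [← hw0]; positivity
  have hd0 : 0 < norm2 d := by
    rcases hn.eq_or_lt with h | h
    · rw [← h] at hsplit; nlinarith
    · exact h
  have h1 := rip_inner Φ (s + t) δ₁ hRIP1 (S ∪ T)
    ((Finset.card_union_le S T).trans (by omega)) d w hdU
    (hwT.trans Finset.subset_union_right) hd0 hw0
  have h2 := ls_orth Φ y T zp hzp w hwT
  have h3 : y - Φ.mulVec zp = Φ.mulVec d + e' := by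
    rw [hy, hd, mulVec_sub]; abel
  rw [h3, add_dotProduct] at h2
  have h4 := dot_le_norm2 e' (Φ.mulVec w)
  have h5 := (hRIP2 w ((Finset.card_le_card hwT).trans hT.le)).2
  have h6 : norm2 (Φ.mulVec w) ≤ Real.sqrt (1 + δ₂) * norm2 w := by
    apply my_le_of_sq_le _ (by positivity)
    rw [mul_pow, Real.sq_sqrt (by linarith)]
    exact h5
  have h7 := mul_le_mul_of_nonneg_left h6 he
  have h8 := (abs_le.1 h4).1
  have h9 := (abs_le.1 h4).2
  refine le_of_mul_le_mul_right ?_ hw0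
  rw [hdw] at h1
  nlinarith
end
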